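/- There exists v ∈ N such that M := 𝒟v is a W-lattice, M is self-dual (M^∨ = M), and M_τ = ∑_{i≥0} τ^i(M) equals Λ₀. In other words, Λ₀ = M_τ for some self-dual Dieudonné lattice M ⊆ N of a-invariant 1. -/

import Mathlib

noncomputable section

open WittVector
open scoped Isocrystal

variable (p : ℕ) [Fact p.Prime] (k : Type*) [Field k] [IsAlgClosed k] [CharP k p]

/-- The Frobenius automorphism `σ` of `K(p, k) = Frac(W(k))`, the unique extension of the
Witt vector Frobenius (itself the unique lift of `x ↦ x^p` on `k`). -/
def sigmaK : K(p, k) ≃+* K(p, k) := WittVector.FractionRing.frobenius p k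

variable (g : ℕ)

/-- `N = K^{2g}`: a pair `(x, y)` encodes the vector `∑ᵢ xᵢ·eᵢ + ∑ᵢ yᵢ·fᵢ` in the basis
`e_1, …, e_g, f_1, …, f_g`. -/
abbrev Nspace := (Fin g → K(p, k)) × (Fin g → K(p, k))

/-- The basis vector `e_i` (0-indexed). -/
def eVec (i : Fin g) : Nspace p k g := (Pi.single i 1, 0)

/-- The basis vector `f_i` (0-indexed). -/
def fVec (i : Fin g) : Nspace p k g := (0, Pi.single i 1)

/-- The `σ`-semilinear Frobenius `F : N → N`, with `F(e_i) = f_i`, `F(f_i) = p·e_i`. -/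
def Fmap (v : Nspace p k g) : Nspace p k g :=
  (fun i => (p : K(p, k)) * sigmaK p k (v.2 i), fun i => sigmaK p k (v.1 i))

/-- The Verschiebung `V = p·F⁻¹ : N → N`, with `V(e_i) = f_i`, `V(f_i) = p·e_i`,
`σ⁻¹`-semilinear. -/
def Vmap (v : Nspace p k g) : Nspace p k g :=
  (fun i => (p : K(p, k)) * (sigmaK p k).symm (v.2 i), fun i => (sigmaK p k).symm (v.1 i))

/-- `τ = p⁻¹·F²` acts coordinatewise by `σ²`. -/
def tauMap (v : Nspace p k g) : Nspace p k g :=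
  (fun i => sigmaK p k (sigmaK p k (v.1 i)), fun i => sigmaK p k (sigmaK p k (v.2 i)))

/-- A `W`-lattice in `N`: a finitely generated `W(k)`-submodule spanning `N` over `K`. -/
def IsLattice (L : Submodule (WittVector p k) (Nspace p k g)) : Prop :=
  L.FG ∧ Submodule.span K(p, k) (L : Set (Nspace p k g)) = ⊤

/-- A Dieudonné lattice: a `W`-lattice `M` with `F(M) ⊆ M` and `p·M ⊆ F(M)`. -/
def IsDieudonneLattice (M : Submodule (WittVector p k) (Nspace p k g)) : Prop :=
  IsLattice p k g M ∧ (∀ v ∈ M, Fmap p k g v ∈ M) ∧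
    ∀ v ∈ M, ∃ w ∈ M, Fmap p k g w = (p : K(p, k)) • v

/-- `L` is `τ`-stable: `τ(L) ⊆ L`. -/
def TauStable (L : Submodule (WittVector p k) (Nspace p k g)) : Prop :=
  ∀ v ∈ L, tauMap p k g v ∈ L

/-- `M_τ = ∑_{i ≥ 0} τ^i(M)`, the `W(k)`-submodule generated by all iterates of `τ`
applied to `M`. -/
def Mtau (M : Submodule (WittVector p k) (Nspace p k g)) :
    Submodule (WittVector p k) (Nspace p k g) :=
  Submodule.span (WittVector p k) (⋃ i : ℕ, (tauMap p k g)^[i] '' (M : Set (Nspace p k g)))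

/-- The symplectic pairing with `⟨e_i, f_{g+1−i}⟩ = 1`, `⟨f_i, e_{g+1−i}⟩ = −1` and all
other pairings of basis vectors zero. -/
def pairN (v w : Nspace p k g) : K(p, k) :=
  ∑ i : Fin g, (v.1 i * w.2 (Fin.rev i) - v.2 i * w.1 (Fin.rev i))

/-- The dual `L^∨ = {x ∈ N : ⟨x, m⟩ ∈ W for all m ∈ L}` of a set `L ⊆ N`. -/
def dualSet (L : Set (Nspace p k g)) : Set (Nspace p k g) :=
  {x | ∀ m ∈ L, ∃ w : WittVector p k, algebraMap (WittVector p k) K(p, k) w = pairN p k g x m}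

/-- `𝒟v`: the `W(k)`-submodule generated by all `F^a V^b v`, `a, b ≥ 0`. -/
def Dspan (v : Nspace p k g) : Submodule (WittVector p k) (Nspace p k g) :=
  Submodule.span (WittVector p k)
    {w | ∃ a b : ℕ, w = (Fmap p k g)^[a] ((Vmap p k g)^[b] v)}

/-- `Π : N → N`, the `K`-linear map with `Π(e_i) = f_i`, `Π(f_i) = p·e_i`
(so `Π² = p·id`). -/
def Pmap (v : Nspace p k g) : Nspace p k g :=
  (fun i => (p : K(p, k)) * v.2 i, v.1)

/-- Integer powers of `Π`: since `Π² = p·id`, one has `Π^c = p^(c div 2)·id` for `c`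
even and `Π^c = p^((c-1)/2)·Π` for `c` odd. -/
def PmapZ (c : ℤ) (v : Nspace p k g) : Nspace p k g :=
  ((p : K(p, k)) ^ (Int.ediv c 2)) • (if Even c then v else Pmap p k g v)

/-- The exponents `c_1, …, c_g` (here `i : Fin g` has 1-based value `i+1`): if `g` is
even, `c_i = 0` for `i ≤ g/2` and `c_i = 1−g` otherwise; if `g` is odd with
`m = (g+1)/2`, `c_i = 0` for `i ≤ m−1`, `c_m = (1−g)/2`, and `c_i = 1−g` for `i > m`. -/
def cExp (i : Fin g) : ℤ :=
  if Even g then (if (i : ℕ) + 1 ≤ g / 2 then 0 else 1 - (g : ℤ))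
  else if (i : ℕ) + 1 ≤ (g + 1) / 2 - 1 then 0
  else if (i : ℕ) + 1 = (g + 1) / 2 then (1 - (g : ℤ)) / 2
  else 1 - (g : ℤ)

/-- The `τ`-stable lattice `Λ₀ = ∑ᵢ (W·Π^{cᵢ}(e_i) + W·Π^{cᵢ+1}(e_i))`. -/
def Lambda0 : Submodule (WittVector p k) (Nspace p k g) :=
  Submodule.span (WittVector p k)
    {w | ∃ i : Fin g, w = PmapZ p k g (cExp g i) (eVec p k g i)
        ∨ w = PmapZ p k g (cExp g i + 1) (eVec p k g i)}

set_option linter.unusedSectionVars false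

/-- The Witt vector Frobenius, as an element of the automorphism group of `W(k)`. -/
def frobAut : RingAut (WittVector p k) := frobeniusEquiv p k

lemma frobAut_zpow_add_apply (a b : ℤ) (x : WittVector p k) :
    (frobAut p k ^ (a + b)) x = (frobAut p k ^ a) ((frobAut p k ^ b) x) := by
  rw [zpow_add]; rfl

lemma coeff_zero_frobAut_pow (n : ℕ) (x : WittVector p k) :
    ((frobAut p k ^ n) x).coeff 0 = x.coeff 0 ^ p ^ n := by
  induction n with
  | zero => simp
  | succ n ih =>
    rw [pow_succ', RingAut.mul_apply]
    change (WittVector.frobenius _).coeff 0 = _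
    rw [coeff_frobenius_charP, ih, ← pow_mul, pow_succ]

lemma isUnit_iff_coeff_zero_ne_zero (x : WittVector p k) : IsUnit x ↔ x.coeff 0 ≠ 0 :=
  ⟨fun h => (h.map (constantCoeff : WittVector p k →+* k)).ne_zero,
    WittVector.isUnit_of_coeff_zero_ne_zero x⟩

lemma p_dvd_iff_coeff_zero (x : WittVector p k) :
    (p : WittVector p k) ∣ x ↔ x.coeff 0 = 0 := by
  rw [← Ideal.mem_span_singleton, mem_span_p_iff_coeff_zero_eq_zero]

/-- Modulo `p`, every Artin–Schreier type equation is solvable. -/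
lemma exists_artinSchreier_mod_p {N : ℕ} (hN : 0 < N) (ε c : WittVector p k) :
    ∃ t : WittVector p k, (p : WittVector p k) ∣ (frobAut p k ^ N) t + ε * t - c := by
  have hpN : 1 < p ^ N := Nat.one_lt_pow hN.ne' (Fact.out : p.Prime).one_lt
  let q : Polynomial k :=
    Polynomial.X ^ p ^ N + (Polynomial.C (ε.coeff 0) * Polynomial.X - Polynomial.C (c.coeff 0))
  have hlow : (Polynomial.C (ε.coeff 0) * Polynomial.X - Polynomial.C (c.coeff 0)).degree
      < ((p ^ N : ℕ) : WithBot ℕ) := by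
    rw [sub_eq_add_neg, ← Polynomial.C_neg]
    exact lt_of_le_of_lt Polynomial.degree_linear_le (by exact_mod_cast hpN)
  have hdeg : q.degree ≠ 0 := by
    have : q.degree = ((p ^ N : ℕ) : WithBot ℕ) := by
      rw [Polynomial.degree_add_eq_left_of_degree_lt]
      · simp
      · simpa using hlow
    rw [this]
    exact_mod_cast (by omega : p ^ N ≠ 0)
  obtain ⟨r, hr⟩ := IsAlgClosed.exists_root q hdeg
  refine ⟨teichmuller p r, ?_⟩
  rw [p_dvd_iff_coeff_zero]
  have h := coeff_zero_frobAut_pow p k N (teichmuller p r)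
  change (constantCoeff : WittVector p k →+* k)
    ((frobAut p k ^ N) (teichmuller p r) + ε * teichmuller p r - c) = 0
  rw [map_sub, map_add, map_mul]
  change ((frobAut p k ^ N) (teichmuller p r)).coeff 0 + ε.coeff 0 * (teichmuller p r).coeff 0
    - c.coeff 0 = 0
  rw [h, teichmuller_coeff_zero]
  simpa [q, Polynomial.IsRoot, add_sub_assoc] using hr

/-- Artin–Schreier type equations `σ^N(β) + ε β = c` are solvable in `W(k)`. -/
lemma exists_artinSchreier {N : ℕ} (hN : 0 < N) (ε c : WittVector p k) :
    ∃ β : WittVector p k, (frobAut p k ^ N) β + ε * β = c := by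
  classical
  let D : WittVector p k → WittVector p k := fun b => (frobAut p k ^ N) b + ε * b - c
  have hstep : ∀ (m : ℕ) (b : WittVector p k), (p : WittVector p k) ^ m ∣ D b →
      ∃ b', (p : WittVector p k) ^ m ∣ b' - b ∧ (p : WittVector p k) ^ (m + 1) ∣ D b' := by
    rintro m b ⟨d, hd⟩
    obtain ⟨t, e, ht⟩ := exists_artinSchreier_mod_p p k hN ε (-d)
    refine ⟨b + p ^ m * t, ⟨t, by ring⟩, ⟨e, ?_⟩⟩
    simp only [D, map_add, map_mul, map_pow, map_natCast] at hd ⊢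
    linear_combination hd + (p : WittVector p k) ^ m * ht
  choose! nxt hnxt using hstep
  let f : ℕ → WittVector p k := fun n => Nat.rec 0 (fun m b => nxt m b) n
  have hf : ∀ n, (p : WittVector p k) ^ n ∣ D (f n) := by
    intro n
    induction n with
    | zero => simp
    | succ n ih => exact (hnxt n _ ih).2
  have hcau : ∀ {m n}, m ≤ n → (p : WittVector p k) ^ m ∣ f n - f m := by
    intro m n hmn
    induction n, hmn using Nat.le_induction with
    | base => simp
    | succ n hmn ih =>
      have h1 : (p : WittVector p k) ^ n ∣ f (n + 1) - f n := (hnxt n _ (hf n)).1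
      have := dvd_add ((pow_dvd_pow _ hmn).trans h1) ih
      simpa using this
  have hAC := isAdicCompleteIdealSpanP (p := p) (k := k)
  obtain ⟨L, hL⟩ := hAC.toIsPrecomplete.prec (f := f) (by
    intro m n hmn
    rw [SModEq.comm, SModEq.sub_mem, smul_eq_mul, Ideal.mul_top, Ideal.span_singleton_pow,
      Ideal.mem_span_singleton]
    exact hcau hmn)
  refine ⟨L, sub_eq_zero.mp (hAC.toIsHausdorff.haus _ fun n => ?_)⟩
  have hLn := hL n
  rw [SModEq.sub_mem, smul_eq_mul, Ideal.mul_top, Ideal.span_singleton_pow,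
    Ideal.mem_span_singleton] at hLn
  rw [SModEq.sub_mem, smul_eq_mul, Ideal.mul_top, Ideal.span_singleton_pow,
    Ideal.mem_span_singleton]
  obtain ⟨d, hd⟩ := hf n
  obtain ⟨e, he⟩ := hLn
  refine ⟨d - (frobAut p k ^ N) e - ε * e, ?_⟩
  have he' := congrArg (frobAut p k ^ N) he
  simp only [D, map_sub, map_mul, map_pow, map_natCast] at hd he'
  linear_combination hd - he' - ε * he

/-- There is a tuple `X` of Witt vectors fixed by `σ^(2n)` together with a dual tuple for the
trace form. -/
lemma exists_dual_tuples {n : ℕ} (hn : 0 < n) :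
    ∃ X Y : Fin n → WittVector p k, ∀ t : ℤ,
      ∑ i, (frobAut p k ^ (2 * t)) (X i) * Y i = if (n : ℤ) ∣ t then 1 else 0 := by
  classical
  have hp : 2 ≤ p := (Fact.out : p.Prime).two_le
  let Q := p ^ (2 * n)
  have hQ4 : 4 ^ n ≤ Q := by
    simp only [Q, pow_mul]
    exact Nat.pow_le_pow_left (by nlinarith) n
  have hQn : n + 2 ≤ Q := le_trans (by
    clear hQ4
    induction n, (show 1 ≤ n from hn) using Nat.le_induction with
    | base => norm_num
    | succ m hm ih => rw [pow_succ]; have := ih hm; omega) hQ4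
  have hne : ((Q - 1 : ℕ) : k) ≠ 0 := by
    rw [Nat.cast_sub (by omega)]
    simp [Q, hn.ne']
  have : NeZero ((Q - 1 : ℕ) : k) := ⟨hne⟩
  obtain ⟨ζ, hζ⟩ := HasEnoughRootsOfUnity.exists_primitiveRoot k (Q - 1)
  let z := teichmuller p ζ
  have hz : ∀ m : ℕ, (frobAut p k ^ m) z = z ^ p ^ m := by
    intro m
    induction m with
    | zero => simp
    | succ m ih =>
      rw [pow_succ', RingAut.mul_apply, ih, map_pow]
      have : frobAut p k z = z ^ p := by
        change WittVector.frobenius (teichmuller p ζ) = _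
        rw [frobenius_eq_map_frobenius, map_teichmuller, ← map_pow]; rfl
      rw [this, ← pow_mul, pow_succ']
  have hfix : (frobAut p k ^ (2 * n)) z = z := by
    rw [hz]
    have : ζ ^ (Q - 1) = 1 := hζ.pow_eq_one
    change z ^ Q = z
    rw [show Q = (Q - 1) + 1 by omega, pow_succ, ← map_pow, this, map_one, one_mul]
  let v : Fin n → WittVector p k := fun j => (frobAut p k ^ (2 * (j : ℕ))) z
  let A := Matrix.vandermonde v
  have hA : IsUnit A.det := by
    rw [isUnit_iff_coeff_zero_ne_zero]
    have h1 : A.det.coeff 0 = (Matrix.vandermonde fun j => (v j).coeff 0).det := by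
      change (constantCoeff : WittVector p k →+* k) _ = _
      rw [RingHom.map_det]
      congr 1
      ext i j
      simp only [A, RingHom.mapMatrix_apply, Matrix.map_apply, Matrix.vandermonde_apply]
      exact map_pow (constantCoeff : WittVector p k →+* k) _ _
    rw [h1, Matrix.det_vandermonde_ne_zero_iff]
    intro i j hij
    simp only [v, coeff_zero_frobAut_pow] at hij
    have hzz : z.coeff 0 = ζ := teichmuller_coeff_zero p ζ
    rw [hzz] at hij
    have hlt : ∀ i : Fin n, p ^ (2 * (i : ℕ)) < Q - 1 := by
      intro i
      have hi : 2 * (i : ℕ) + 2 ≤ 2 * n := by omega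
      have : p ^ (2 * (i : ℕ) + 2) ≤ Q := Nat.pow_le_pow_right (by omega) hi
      rw [pow_add] at this
      have h2 : 0 < p ^ (2 * (i : ℕ)) := by positivity
      have h4 : p ^ (2 * (i : ℕ)) * 4 ≤ p ^ (2 * (i : ℕ)) * p ^ 2 :=
        Nat.mul_le_mul_left _ (by nlinarith)
      omega
    have := hζ.pow_inj (hlt i) (hlt j) hij
    have := Nat.pow_right_injective hp this
    exact Fin.ext (by omega)
  refine ⟨fun i => z ^ (i : ℕ), A⁻¹.mulVec (Pi.single ⟨0, hn⟩ 1), fun t => ?_⟩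
  have hper : ∀ q : ℤ, (frobAut p k ^ (2 * (n : ℤ) * q)) z = z := by
    have h1 : frobAut p k ^ (2 * (n : ℤ)) ∈ MulAction.stabilizer (RingAut (WittVector p k)) z := by
      rw [MulAction.mem_stabilizer_iff]
      exact_mod_cast hfix
    intro q
    have h2 := Subgroup.zpow_mem _ h1 q
    rw [MulAction.mem_stabilizer_iff, ← zpow_mul] at h2
    exact h2
  have hn' : (0 : ℤ) < n := by exact_mod_cast hn
  obtain ⟨j, hj⟩ : ∃ j : ℕ, (j : ℤ) = t % n := ⟨(t % n).toNat, by
    rw [Int.toNat_of_nonneg (Int.emod_nonneg _ hn'.ne')]⟩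
  have hjn : j < n := by
    have := Int.emod_lt_of_pos t hn'
    omega
  have hzt : (frobAut p k ^ (2 * t)) z = v ⟨j, hjn⟩ := by
    have : 2 * t = ((2 * j : ℕ) : ℤ) + 2 * (n : ℤ) * (t / n) := by
      push_cast
      rw [hj]
      linear_combination -2 * Int.emod_add_mul_ediv t n
    rw [this, frobAut_zpow_add_apply, hper, zpow_natCast]
  have hmul := congrFun (show A.mulVec (A⁻¹.mulVec (Pi.single ⟨0, hn⟩ 1)) = Pi.single ⟨0, hn⟩ 1 by
    rw [Matrix.mulVec_mulVec, Matrix.mul_nonsing_inv _ hA, Matrix.one_mulVec]) ⟨j, hjn⟩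
  simp only [map_pow, hzt]
  refine (show _ = _ from hmul).trans ?_
  rw [Pi.single_apply]
  refine if_congr ?_ rfl rfl
  rw [Fin.mk.injEq, Int.dvd_iff_emod_eq_zero, ← hj]
  omega

/-- The sign `(-1)^{c_i}`. -/
def cSign (i : Fin g) : WittVector p k := if Even (cExp g i) then 1 else -1

/-- The `σ^a`-sesquilinear value `∑ (-1)^{c_i} x_i σ^a(x_{g+1-i})`. -/
def twistForm (x : Fin g → WittVector p k) (a : ℤ) : WittVector p k :=
  ∑ i, cSign p k g i * (x i * (frobAut p k ^ a) (x (Fin.rev i)))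

lemma cExp_add_cExp_rev (i : Fin g) : cExp g i + cExp g (Fin.rev i) = 1 - g := by
  have hi := i.2
  rcases Nat.even_or_odd' g with ⟨h, rfl | rfl⟩
  · simp only [cExp, Fin.val_rev, even_two_mul, if_true]
    split_ifs <;> omega
  · have hodd : ¬ Even (2 * h + 1) := by simp
    simp only [cExp, Fin.val_rev, if_neg hodd]
    split_ifs <;> omega

lemma twistForm_eq_even (h : ℕ) (X Y : Fin h → WittVector p k) (a : ℤ) :
    twistForm p k (h + h) (Fin.append X (Y ∘ Fin.rev)) a =
      ∑ i, X i * (frobAut p k ^ a) (Y i) - ∑ i, Y i * (frobAut p k ^ a) (X i) := by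
  have hs1 : ∀ i : Fin h, cSign p k (h + h) (Fin.castAdd h i) = 1 := by
    intro i
    have hi := i.2
    have : cExp (h + h) (Fin.castAdd h i) = 0 := by
      rw [cExp, if_pos (Even.add_self h), if_pos]
      simp only [Fin.val_castAdd]; omega
    simp [cSign, this]
  have hs2 : ∀ i : Fin h, cSign p k (h + h) (Fin.natAdd h i) = -1 := by
    intro i
    have : cExp (h + h) (Fin.natAdd h i) = 1 - ((h + h : ℕ) : ℤ) := by
      rw [cExp, if_pos (Even.add_self h), if_neg]
      simp only [Fin.val_natAdd]; omega
    have hodd : ¬ Even (1 - ((h + h : ℕ) : ℤ)) := by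
      rw [Int.even_iff]; omega
    rw [cSign, this, if_neg hodd]
  have hr1 : ∀ i : Fin h, Fin.rev (Fin.castAdd h i) = Fin.natAdd h (Fin.rev i) := by
    intro i; ext; simp [Fin.val_rev]; omega
  have hr2 : ∀ i : Fin h, Fin.rev (Fin.natAdd h i) = Fin.castAdd h (Fin.rev i) := by
    intro i; ext; simp [Fin.val_rev]; omega
  rw [twistForm, Fin.sum_univ_add, sub_eq_add_neg]
  simp only [hs1, hs2, hr1, hr2, Fin.append_left, Fin.append_right, Function.comp_apply,
    Fin.rev_rev, one_mul, neg_one_mul, Finset.sum_neg_distrib]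
  congr 2
  exact Equiv.sum_comp Fin.revPerm fun i => Y i * (frobAut p k ^ a) (X i)

lemma twistForm_eq_odd (n : ℕ) : ∃ s : WittVector p k, (s = 1 ∨ s = -1) ∧
    ∀ (X Y : Fin n → WittVector p k) (z : WittVector p k) (a : ℤ),
      twistForm p k (n + 1 + n) (Fin.append (Fin.append X fun _ => z) (Y ∘ Fin.rev)) a =
        ∑ i, X i * (frobAut p k ^ a) (Y i) + ∑ i, Y i * (frobAut p k ^ a) (X i)
          + s * (z * (frobAut p k ^ a) z) := by
  have hne : ¬ Even (n + 1 + n) := by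
    rw [Nat.even_iff]; omega
  refine ⟨cSign p k (n + 1 + n) (Fin.castAdd n (Fin.natAdd n 0)), ?_, fun X Y z a => ?_⟩
  · rw [cSign]; split_ifs
    exacts [Or.inl rfl, Or.inr rfl]
  have hs1 : ∀ i : Fin n, cSign p k (n + 1 + n) (Fin.castAdd n (Fin.castAdd 1 i)) = 1 := by
    intro i
    have hi := i.2
    have : cExp (n + 1 + n) (Fin.castAdd n (Fin.castAdd 1 i)) = 0 := by
      rw [cExp, if_neg hne, if_pos]
      simp only [Fin.val_castAdd]; omega
    simp [cSign, this]
  have hs2 : ∀ i : Fin n, cSign p k (n + 1 + n) (Fin.natAdd (n + 1) i) = 1 := by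
    intro i
    have : cExp (n + 1 + n) (Fin.natAdd (n + 1) i) = 1 - ((n + 1 + n : ℕ) : ℤ) := by
      rw [cExp, if_neg hne, if_neg, if_neg] <;> simp only [Fin.val_natAdd] <;> omega
    have hev : Even (1 - ((n + 1 + n : ℕ) : ℤ)) := by
      rw [Int.even_iff]; omega
    rw [cSign, this, if_pos hev]
  have hr1 : ∀ i : Fin n, Fin.rev (Fin.castAdd n (Fin.castAdd 1 i))
      = Fin.natAdd (n + 1) (Fin.rev i) := by
    intro i; ext; simp [Fin.val_rev]; omega
  have hr2 : ∀ i : Fin n, Fin.rev (Fin.natAdd (n + 1) i)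
      = Fin.castAdd n (Fin.castAdd 1 (Fin.rev i)) := by
    intro i; ext; simp [Fin.val_rev]; omega
  have hr3 : Fin.rev (Fin.castAdd n (Fin.natAdd n (0 : Fin 1)))
      = Fin.castAdd n (Fin.natAdd n 0) := by
    ext; simp [Fin.val_rev]
  rw [twistForm, Fin.sum_univ_add, Fin.sum_univ_add]
  simp only [hs1, hs2, hr1, hr2, hr3, Fin.append_left, Fin.append_right, Function.comp_apply,
    Fin.rev_rev, one_mul, Finset.univ_unique, Finset.sum_singleton, Fin.default_eq_zero]
  rw [add_right_comm]
  congr 2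
  exact Equiv.sum_comp Fin.revPerm fun i => Y i * (frobAut p k ^ a) (X i)

lemma frobAut_zpow_sum_mul {n : ℕ} (X Y : Fin n → WittVector p k) (a : ℤ) :
    ∑ i, X i * (frobAut p k ^ a) (Y i)
      = (frobAut p k ^ a) (∑ i, (frobAut p k ^ (-a)) (X i) * Y i) := by
  simp only [map_sum, map_mul, ← frobAut_zpow_add_apply]
  simp

/-- Solution of the coupled system `β_b + σ^(2b+1)(β_{n-1-b}) = c_b`. -/
lemma exists_coupled_solution {n : ℕ} (hn : 0 < n) (c : Fin n → WittVector p k) :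
    ∃ β : Fin n → WittVector p k,
      ∀ b, β b + (frobAut p k ^ (2 * (b : ℤ) + 1)) (β (Fin.rev b)) = c b := by
  have hD : ∀ d : WittVector p k, ∃ β, β - (frobAut p k ^ (2 * (n : ℤ))) β = d := by
    intro d
    obtain ⟨β, hβ⟩ := exists_artinSchreier p k (show 0 < 2 * n by omega) (-1) (-d)
    refine ⟨β, ?_⟩
    have : (frobAut p k ^ (2 * (n : ℤ))) β = (frobAut p k ^ (2 * n)) β := by
      rw [← zpow_natCast]; norm_cast
    rw [this]
    linear_combination -hβ
  choose D hD using hD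
  have hmid : ∀ b : Fin n, ∃ β, β + (frobAut p k ^ (2 * (b : ℤ) + 1)) β = c b := by
    intro b
    obtain ⟨β, hβ⟩ := exists_artinSchreier p k (show 0 < 2 * (b : ℕ) + 1 by omega) 1 (c b)
    refine ⟨β, ?_⟩
    have : (frobAut p k ^ (2 * (b : ℤ) + 1)) β = (frobAut p k ^ (2 * (b : ℕ) + 1)) β := by
      rw [← zpow_natCast]; norm_cast
    rw [this]
    linear_combination hβ
  choose E hE using hmid
  let d : Fin n → WittVector p k := fun b =>
    D (c b - (frobAut p k ^ (2 * (b : ℤ) + 1)) (c (Fin.rev b)))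
  refine ⟨fun b => if b < Fin.rev b then d b else if b = Fin.rev b then E b else
    c b - (frobAut p k ^ (2 * (b : ℤ) + 1)) (d (Fin.rev b)), fun b => ?_⟩
  rcases lt_trichotomy b (Fin.rev b) with h | h | h
  · have h' : ¬ Fin.rev b < b := not_lt.mpr h.le
    simp only [Fin.rev_rev, if_pos h, if_neg h', if_neg h.ne']
    rw [map_sub, ← frobAut_zpow_add_apply]
    have : 2 * (b : ℤ) + 1 + (2 * ((Fin.rev b : Fin n) : ℤ) + 1) = 2 * n := by
      have := b.2
      rw [Fin.val_rev]; omega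
    rw [this]
    linear_combination hD (c b - (frobAut p k ^ (2 * (b : ℤ) + 1)) (c (Fin.rev b)))
  · have h' : ¬ b < Fin.rev b := not_lt.mpr h.ge
    have h'' : ¬ Fin.rev b < b := not_lt.mpr h.le
    simp only [Fin.rev_rev, if_neg h', if_neg h'', if_pos h, if_pos h.symm]
    rw [← h]
    exact hE b
  · have h' : ¬ b < Fin.rev b := not_lt.mpr h.le
    simp only [Fin.rev_rev, if_neg h', if_neg h.ne', if_pos h]
    ring

lemma exists_twistForm_even (h : ℕ) (hh : 0 < h) :
    ∃ x : Fin (h + h) → WittVector p k,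
      (∀ a : ℤ, 0 ≤ a → a < (h + h : ℕ) → Even (a - (h + h : ℕ)) →
        twistForm p k (h + h) x a = 0) ∧ IsUnit (twistForm p k (h + h) x (h + h : ℕ)) := by
  obtain ⟨X, Xs, hX⟩ := exists_dual_tuples p k hh
  obtain ⟨β, hβ⟩ := exists_artinSchreier p k (show 0 < h + h by omega) (-1) 1
  have key : ∀ t : ℤ, twistForm p k (h + h) (Fin.append X ((fun i => β * Xs i) ∘ Fin.rev)) (2 * t)
      = if (h : ℤ) ∣ t then (frobAut p k ^ (2 * t)) β - β else 0 := by
    intro t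
    have h1 : ∀ u : ℤ, ∑ i, (frobAut p k ^ (2 * u)) (X i) * (β * Xs i)
        = β * if (h : ℤ) ∣ u then 1 else 0 := by
      intro u
      rw [← hX, Finset.mul_sum]
      exact Finset.sum_congr rfl fun i _ => by ring
    rw [twistForm_eq_even, frobAut_zpow_sum_mul, ← mul_neg, h1]
    simp only [mul_comm (β * _)]
    rw [h1]
    simp only [dvd_neg]
    split_ifs <;> simp
  refine ⟨Fin.append X ((fun i => β * Xs i) ∘ Fin.rev), fun a ha hag hev => ?_, ?_⟩
  · obtain ⟨t, rfl⟩ : ∃ t, a = 2 * t := by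
      obtain ⟨r, hr⟩ := hev
      exact ⟨r + h, by push_cast at hr; linarith⟩
    rw [key]
    rcases ha.eq_or_lt with h0 | h0
    · obtain rfl : t = 0 := by omega
      simp
    rw [if_neg]
    intro hd
    have := Int.le_of_dvd (by omega) hd
    push_cast at hag
    omega
  · rw [show ((h + h : ℕ) : ℤ) = 2 * (h : ℤ) by push_cast; ring, key, if_pos dvd_rfl]
    have : (frobAut p k ^ (2 * (h : ℤ))) β = (frobAut p k ^ (h + h)) β := by
      rw [← zpow_natCast]; push_cast; ring_nf
    rw [this, show (frobAut p k ^ (h + h)) β - β = 1 by linear_combination hβ]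
    exact isUnit_one

lemma exists_twistForm_odd (n : ℕ) :
    ∃ x : Fin (n + 1 + n) → WittVector p k,
      (∀ a : ℤ, 0 ≤ a → a < (n + 1 + n : ℕ) → Even (a - (n + 1 + n : ℕ)) →
        twistForm p k (n + 1 + n) x a = 0) ∧
      IsUnit (twistForm p k (n + 1 + n) x (n + 1 + n : ℕ)) := by
  obtain ⟨s, hs, hform⟩ := twistForm_eq_odd p k n
  rcases Nat.eq_zero_or_pos n with rfl | hn
  · refine ⟨Fin.append (Fin.append Fin.elim0 fun _ => 1) (Fin.elim0 ∘ Fin.rev),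
      fun a ha hag => ?_, ?_⟩
    · rintro ⟨r, hr⟩
      push_cast at hag hr; omega
    · rw [hform]
      rcases hs with rfl | rfl <;> simp
  obtain ⟨X, Xs, hX⟩ := exists_dual_tuples p k hn
  obtain ⟨z, hz⟩ := exists_artinSchreier p k (show 0 < 2 * n by omega) (-1) 1
  have hz' : (frobAut p k ^ (2 * (n : ℤ))) z = z + 1 := by
    have : (frobAut p k ^ (2 * (n : ℤ))) z = (frobAut p k ^ (2 * n)) z := by
      rw [← zpow_natCast]; norm_cast
    rw [this]
    linear_combination hz
  obtain ⟨β, hβ⟩ := exists_coupled_solution p k hn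
    (fun b => -s * (z * (frobAut p k ^ (2 * (b : ℤ) + 1)) z))
  let Y : Fin n → WittVector p k := fun i =>
    ∑ b : Fin n, β b * (frobAut p k ^ (2 * (b : ℤ) + 1)) (Xs i)
  have hY : ∀ (w : ℤ) (b₀ : Fin n), (n : ℤ) ∣ w - b₀ →
      ∑ i, (frobAut p k ^ (2 * w + 1)) (X i) * Y i = β b₀ := by
    intro w b₀ hw
    have h1 : ∑ i, (frobAut p k ^ (2 * w + 1)) (X i) * Y i
        = ∑ b : Fin n, β b * (frobAut p k ^ (2 * (b : ℤ) + 1))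
          (∑ i, (frobAut p k ^ (2 * (w - b))) (X i) * Xs i) := by
      simp only [Y, Finset.mul_sum, map_sum, map_mul, ← frobAut_zpow_add_apply]
      rw [Finset.sum_comm]
      refine Finset.sum_congr rfl fun b _ => Finset.sum_congr rfl fun i _ => ?_
      rw [show 2 * (b : ℤ) + 1 + 2 * (w - b) = 2 * w + 1 by ring]
      ring
    rw [h1, Finset.sum_eq_single b₀]
    · rw [hX, if_pos hw]; simp
    · intro b _ hb
      rw [hX, if_neg]
      · simp
      · intro hd
        have h2 : (n : ℤ) ∣ (b : ℤ) - b₀ := by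
          have := dvd_sub hw hd
          rwa [show w - b₀ - (w - b) = (b : ℤ) - b₀ by ring] at this
        have := Int.eq_zero_of_abs_lt_dvd h2 (by have := b.2; have := b₀.2; rw [abs_lt]; omega)
        exact hb (Fin.ext (by omega))
    · simp
  have hkey : ∀ (w : ℤ) (b₀ : Fin n), (n : ℤ) ∣ w - b₀ →
      twistForm p k (n + 1 + n) (Fin.append (Fin.append X fun _ => z) (Y ∘ Fin.rev)) (2 * w + 1)
        = (frobAut p k ^ (2 * w + 1)) (β (Fin.rev b₀)) + β b₀
          + s * (z * (frobAut p k ^ (2 * w + 1)) z) := by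
    intro w b₀ hw
    rw [hform, frobAut_zpow_sum_mul, show -(2 * w + 1) = 2 * (-w - 1) + 1 by ring,
      hY (-w - 1) (Fin.rev b₀)]
    · simp only [mul_comm (Y _)]
      rw [hY w b₀ hw]
    · have h1 : -w - 1 - ((Fin.rev b₀ : Fin n) : ℤ) = -(w - b₀) - n := by
        have := b₀.2
        rw [Fin.val_rev]; omega
      rw [h1]
      exact dvd_sub ((dvd_neg).mpr hw) dvd_rfl
  refine ⟨Fin.append (Fin.append X fun _ => z) (Y ∘ Fin.rev), fun a ha hag hev => ?_, ?_⟩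
  · obtain ⟨b, rfl⟩ : ∃ b : Fin n, a = 2 * (b : ℤ) + 1 := by
      obtain ⟨r, hr⟩ := hev
      push_cast at hr hag
      refine ⟨⟨(r + n).toNat, by omega⟩, ?_⟩
      simp only [Int.toNat_of_nonneg (show 0 ≤ r + n by omega)]
      omega
    rw [hkey b b (by simp)]
    linear_combination hβ b
  · let b₀ : Fin n := ⟨0, hn⟩
    have h0 := hβ b₀
    rw [show ((n + 1 + n : ℕ) : ℤ) = 2 * (n : ℤ) + 1 by push_cast; ring, hkey n b₀ (by simp [b₀])]
    have hσs : (frobAut p k ^ (2 * (n : ℤ))) s = s := by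
      rcases hs with rfl | rfl <;> simp
    have h1 := congrArg (frobAut p k ^ (2 * (n : ℤ))) h0
    have h2 := hβ (Fin.rev b₀)
    have h3 : (frobAut p k ^ (2 * (n : ℤ) + 1)) z = (frobAut p k ^ (1 : ℤ)) z + 1 := by
      rw [add_comm (2 * (n : ℤ)), frobAut_zpow_add_apply, hz', map_add, map_one]
    have h4 := congrArg (frobAut p k ^ (1 : ℤ)) h2
    have h5 : 2 * ((Fin.rev b₀ : Fin n) : ℤ) + 1 = 2 * n - 1 := by
      rw [Fin.val_rev]; simp only [b₀]; omega
    have hσs1 : (frobAut p k ^ (1 : ℤ)) s = s := by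
      rcases hs with rfl | rfl <;> simp
    simp only [b₀, Nat.cast_zero, mul_zero, zero_add] at h0 h1
    simp only [map_add, map_mul, map_neg, hσs, hz', ← frobAut_zpow_add_apply, h3] at h1
    rw [h3]
    have : (frobAut p k ^ (2 * (n : ℤ) + 1)) (β (Fin.rev b₀)) + β b₀
        + s * (z * ((frobAut p k ^ (1 : ℤ)) z + 1)) = -s := by
      rw [h5] at h4
      simp only [map_add, map_mul, map_neg, hσs1, ← frobAut_zpow_add_apply, Fin.rev_rev,
        add_sub_cancel, hz'] at h4
      linear_combination h1 + h0 - h4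
    rw [this]
    rcases hs with rfl | rfl <;> simp

lemma exists_twistForm (hg : 1 ≤ g) :
    ∃ x : Fin g → WittVector p k,
      (∀ a : ℤ, 0 ≤ a → a < g → Even (a - g) → twistForm p k g x a = 0) ∧
      IsUnit (twistForm p k g x g) := by
  rcases Nat.even_or_odd' g with ⟨h, hgh | hgh⟩
  · obtain rfl : g = h + h := by omega
    exact exists_twistForm_even p k h (by omega)
  · obtain rfl : g = h + 1 + h := by omega
    exact exists_twistForm_odd p k h
lemma cSign_rev (i : Fin g) :
    cSign p k g (Fin.rev i) = (if Even g then -1 else 1) * cSign p k g i := by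
  have h := cExp_add_cExp_rev g i
  simp only [cSign, ← Int.even_coe_nat g, Int.even_iff]
  split_ifs <;> first | omega | simp

lemma twistForm_neg (x : Fin g → WittVector p k) (a : ℤ) :
    (frobAut p k ^ a) (twistForm p k g x (-a))
      = (if Even g then -1 else 1) * twistForm p k g x a := by
  have hs : ∀ i, (frobAut p k ^ a) (cSign p k g i) = cSign p k g i := by
    intro i; rw [cSign]; split_ifs <;> simp
  simp only [twistForm, map_sum, map_mul, hs, ← frobAut_zpow_add_apply, add_neg_cancel, zpow_zero,
    RingAut.one_apply, Finset.mul_sum]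
  rw [← Equiv.sum_comp Fin.revPerm]
  refine Finset.sum_congr rfl fun i _ => ?_
  simp only [Fin.revPerm_apply, Fin.rev_rev, cSign_rev]
  ring

lemma twistForm_eq_zero {x : Fin g → WittVector p k}
    (hx : ∀ a : ℤ, 0 ≤ a → a < g → Even (a - g) → twistForm p k g x a = 0)
    {a : ℤ} (h1 : -(g : ℤ) < a) (h2 : a < g) (h3 : Even (a - g)) : twistForm p k g x a = 0 := by
  rcases le_total 0 a with h | h
  · exact hx a h h2 h3
  · have h4 := twistForm_neg p k g x (-a)
    rw [neg_neg, hx (-a) (by omega) (by omega) (by rw [Int.even_iff] at h3 ⊢; omega),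
      mul_zero] at h4
    exact (map_eq_zero_iff _ (frobAut p k ^ (-a)).injective).mp h4

/-- `p^(c/2)` for even `c`, and zero for odd `c`. -/
def halfPow (c : ℤ) : K(p, k) := if Even c then (p : K(p, k)) ^ (c / 2) else 0

lemma p_ne_zero_fractionRing : (p : K(p, k)) ≠ 0 := WittVector.FractionRing.p_nonzero p k

lemma halfPow_add_two (c : ℤ) : halfPow p k (c + 2) = p * halfPow p k c := by
  have hev : Even (c + 2) ↔ Even c := by simp only [Int.even_iff]; omega
  simp only [halfPow, hev]
  split_ifs
  · rw [show (c + 2) / 2 = 1 + c / 2 by omega, zpow_one_add₀ (p_ne_zero_fractionRing p k)]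
  · simp

lemma sigmaK_halfPow (c : ℤ) : sigmaK p k (halfPow p k c) = halfPow p k c := by
  rw [halfPow]; split_ifs <;> simp

lemma halfPow_mul_sub (a b : ℤ) :
    halfPow p k a * halfPow p k b - halfPow p k (a - 1) * halfPow p k (b + 1)
      = (if Even a then 1 else -1) * halfPow p k (a + b) := by
  have h1 : Even (a - 1) ↔ ¬ Even a := by simp only [Int.even_iff]; omega
  have h2 : Even (b + 1) ↔ ¬ Even b := by simp only [Int.even_iff]; omega
  simp only [halfPow, h1, h2, Int.even_add]
  have hp := p_ne_zero_fractionRing p k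
  by_cases ha : Even a <;> by_cases hb : Even b <;> simp only [ha, hb, if_true, if_false, not_true,
    not_false_iff, iff_self, iff_false, iff_true, mul_zero, zero_mul, sub_zero, sub_self, zero_sub,
    ← zpow_add₀ hp]
  · rw [one_mul]
    congr 1
    rw [Int.even_iff] at ha hb; omega
  · rw [neg_one_mul]
    congr 2
    rw [Int.even_iff] at ha hb; omega

/-- The vector `Π^(c_i + n)(e_i)` in coordinates. -/
def piVec (i : Fin g) (n : ℤ) : Nspace p k g :=
  (Pi.single i (halfPow p k (cExp g i + n)), Pi.single i (halfPow p k (cExp g i + n - 1)))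

lemma PmapZ_eVec (c : ℤ) (i : Fin g) :
    PmapZ p k g c (eVec p k g i)
      = (Pi.single i (halfPow p k c), Pi.single i (halfPow p k (c - 1))) := by
  have h1 : Even (c - 1) ↔ ¬ Even c := by simp only [Int.even_iff]; omega
  have hdiv : Int.ediv c 2 = c / 2 := rfl
  simp only [PmapZ, halfPow, h1, hdiv]
  split_ifs with h
  · simp [eVec, ← Pi.single_smul]
  · have h2 : (c - 1) / 2 = c / 2 := by rw [Int.even_iff] at h; omega
    rw [h2]
    ext j <;> simp [Pmap, eVec, Pi.single_apply]

lemma Lambda0_eq : Lambda0 p k g = Submodule.span (WittVector p k)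
    {w | ∃ i : Fin g, w = piVec p k g i 0 ∨ w = piVec p k g i 1} := by
  simp only [Lambda0, PmapZ_eVec, piVec, add_zero]

lemma piVec_add_two (i : Fin g) (n : ℤ) :
    piVec p k g i (n + 2) = (p : WittVector p k) • piVec p k g i n := by
  have h1 : cExp g i + (n + 2) = cExp g i + n + 2 := by ring
  have h2 : cExp g i + n + 2 - 1 = cExp g i + n - 1 + 2 := by ring
  ext j
  all_goals
    simp only [piVec, h1, h2, halfPow_add_two, Prod.smul_fst, Prod.smul_snd, Pi.smul_apply,
      Pi.single_apply]
    split_ifs <;> simp [Algebra.smul_def]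

lemma sigmaK_algebraMap (r : WittVector p k) :
    sigmaK p k (algebraMap _ _ r) = algebraMap (WittVector p k) K(p, k) (frobAut p k r) :=
  IsFractionRing.ringEquivOfRingEquiv_algebraMap _ _

lemma sigmaK_symm_algebraMap (r : WittVector p k) :
    (sigmaK p k).symm (algebraMap _ _ r)
      = algebraMap (WittVector p k) K(p, k) ((frobAut p k)⁻¹ r) := by
  rw [RingEquiv.symm_apply_eq, sigmaK_algebraMap, ← RingAut.mul_apply, mul_inv_cancel]
  rfl

/-- The vector `∑ σ^t(x_i) Π^(c_i + n)(e_i)`. -/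
def twistVec (x : Fin g → WittVector p k) (t n : ℤ) : Nspace p k g :=
  ∑ i, (frobAut p k ^ t) (x i) • piVec p k g i n

lemma twistVec_fst (x : Fin g → WittVector p k) (t n : ℤ) (i : Fin g) :
    (twistVec p k g x t n).1 i
      = algebraMap _ _ ((frobAut p k ^ t) (x i)) * halfPow p k (cExp g i + n) := by
  simp [twistVec, piVec, Prod.fst_sum, Finset.sum_apply, Pi.single_apply, Algebra.smul_def]

lemma twistVec_snd (x : Fin g → WittVector p k) (t n : ℤ) (i : Fin g) :
    (twistVec p k g x t n).2 i
      = algebraMap _ _ ((frobAut p k ^ t) (x i)) * halfPow p k (cExp g i + n - 1) := by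
  simp [twistVec, piVec, Prod.snd_sum, Finset.sum_apply, Pi.single_apply, Algebra.smul_def]

lemma frobAut_apply_zpow (t : ℤ) (r : WittVector p k) :
    frobAut p k ((frobAut p k ^ t) r) = (frobAut p k ^ (t + 1)) r := by
  rw [add_comm, frobAut_zpow_add_apply, zpow_one]

lemma frobAut_inv_apply_zpow (t : ℤ) (r : WittVector p k) :
    (frobAut p k)⁻¹ ((frobAut p k ^ t) r) = (frobAut p k ^ (t - 1)) r := by
  rw [sub_eq_neg_add, frobAut_zpow_add_apply, zpow_neg_one]

lemma Fmap_twistVec (x : Fin g → WittVector p k) (t n : ℤ) :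
    Fmap p k g (twistVec p k g x t n) = twistVec p k g x (t + 1) (n + 1) := by
  ext i
  · simp only [Fmap, twistVec_fst, twistVec_snd, map_mul, sigmaK_halfPow, sigmaK_algebraMap,
      frobAut_apply_zpow]
    rw [show cExp g i + (n + 1) = cExp g i + n - 1 + 2 by ring, halfPow_add_two]
    ring
  · simp only [Fmap, twistVec_fst, twistVec_snd, map_mul, sigmaK_halfPow, sigmaK_algebraMap,
      frobAut_apply_zpow]
    rw [show cExp g i + (n + 1) - 1 = cExp g i + n by ring]

lemma Vmap_twistVec (x : Fin g → WittVector p k) (t n : ℤ) :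
    Vmap p k g (twistVec p k g x t n) = twistVec p k g x (t - 1) (n + 1) := by
  have h : ∀ c, (sigmaK p k).symm (halfPow p k c) = halfPow p k c := fun c => by
    rw [RingEquiv.symm_apply_eq, sigmaK_halfPow]
  ext i
  · simp only [Vmap, twistVec_fst, twistVec_snd, map_mul, h, sigmaK_symm_algebraMap,
      frobAut_inv_apply_zpow]
    rw [show cExp g i + (n + 1) = cExp g i + n - 1 + 2 by ring, halfPow_add_two]
    ring
  · simp only [Vmap, twistVec_fst, twistVec_snd, map_mul, h, sigmaK_symm_algebraMap,
      frobAut_inv_apply_zpow]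
    rw [show cExp g i + (n + 1) - 1 = cExp g i + n by ring]

lemma tauMap_twistVec (x : Fin g → WittVector p k) (t n : ℤ) :
    tauMap p k g (twistVec p k g x t n) = twistVec p k g x (t + 2) n := by
  ext i
  all_goals
    simp only [tauMap, twistVec_fst, twistVec_snd, map_mul, sigmaK_halfPow, sigmaK_algebraMap,
      frobAut_apply_zpow]
    rw [show t + 1 + 1 = t + 2 by ring]

lemma Fmap_iterate_twistVec (x : Fin g → WittVector p k) (t n : ℤ) (a : ℕ) :
    (Fmap p k g)^[a] (twistVec p k g x t n) = twistVec p k g x (t + a) (n + a) := by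
  induction a with
  | zero => simp
  | succ a ih =>
    rw [Function.iterate_succ_apply', ih, Fmap_twistVec]
    push_cast
    rw [add_assoc, add_assoc]

lemma Vmap_iterate_twistVec (x : Fin g → WittVector p k) (t n : ℤ) (b : ℕ) :
    (Vmap p k g)^[b] (twistVec p k g x t n) = twistVec p k g x (t - b) (n + b) := by
  induction b with
  | zero => simp
  | succ b ih =>
    rw [Function.iterate_succ_apply', ih, Vmap_twistVec]
    push_cast
    rw [sub_sub, add_assoc]

lemma tauMap_iterate_twistVec (x : Fin g → WittVector p k) (t n : ℤ) (j : ℕ) :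
    (tauMap p k g)^[j] (twistVec p k g x t n) = twistVec p k g x (t + 2 * j) n := by
  induction j with
  | zero => simp
  | succ j ih =>
    rw [Function.iterate_succ_apply', ih, tauMap_twistVec]
    push_cast
    rw [add_assoc, mul_add, mul_one]

lemma Dspan_twistVec (x : Fin g → WittVector p k) :
    Dspan p k g (twistVec p k g x 0 0) = Submodule.span (WittVector p k)
      {w | ∃ a b : ℕ, w = twistVec p k g x (a - b) (a + b)} := by
  simp only [Dspan, Vmap_iterate_twistVec, Fmap_iterate_twistVec]
  congr 1
  ext w
  refine exists_congr fun a => exists_congr fun b => ?_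
  rw [show (0 : ℤ) - b + a = a - b by ring, show (0 : ℤ) + b + a = a + b by ring]

lemma pairN_twistVec (x : Fin g → WittVector p k) (t n s m : ℤ) :
    pairN p k g (twistVec p k g x t n) (twistVec p k g x s m)
      = halfPow p k (n + m - g) * algebraMap (WittVector p k) K(p, k)
          ((if Even n then 1 else -1) * (frobAut p k ^ t) (twistForm p k g x (s - t))) := by
  have hs : ∀ i, (frobAut p k ^ t) (cSign p k g i) = cSign p k g i := by
    intro i; rw [cSign]; split_ifs <;> simp
  simp only [pairN, twistForm, twistVec_fst, twistVec_snd, map_sum, map_mul, Finset.mul_sum, hs,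
    ← frobAut_zpow_add_apply, add_sub_cancel]
  refine Finset.sum_congr rfl fun i _ => ?_
  have h1 := halfPow_mul_sub p k (cExp g i + n) (cExp g (Fin.rev i) + m - 1)
  have h2 := cExp_add_cExp_rev g i
  rw [show cExp g i + n + (cExp g (Fin.rev i) + m - 1) = n + m - g by linarith,
    show cExp g (Fin.rev i) + m - 1 + 1 = cExp g (Fin.rev i) + m by ring] at h1
  have h3 : (if Even (cExp g i + n) then (1 : K(p, k)) else -1)
      = algebraMap (WittVector p k) K(p, k) (if Even n then 1 else -1)
        * algebraMap (WittVector p k) K(p, k) (cSign p k g i) := by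
    simp only [cSign, Int.even_add]
    by_cases ha : Even (cExp g i) <;> by_cases hb : Even n <;> simp [ha, hb]
  rw [h3] at h1
  linear_combination algebraMap (WittVector p k) K(p, k) ((frobAut p k ^ t) (x i))
    * algebraMap (WittVector p k) K(p, k) ((frobAut p k ^ s) (x (Fin.rev i))) * h1

/-- Two isotropic families of `n` vectors in a `2n`-dimensional alternating space over the fraction
field of `R`, whose cross Gram matrix is invertible over `R`, span a unimodular lattice. -/
lemma unimodular_of_isotropic {R K V : Type*} [CommRing R] [Field K] [Algebra R K]
    [AddCommGroup V] [Module K V] [Module R V] [IsScalarTower R K V] [FiniteDimensional K V] {n : ℕ}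
    (hV : Module.finrank K V = n + n) (B : V →ₗ[K] V →ₗ[K] K) (hB : ∀ x y, B x y = -B y x)
    (P Q : Fin n → V) (hP : ∀ i j, B (P i) (P j) = 0) (hQ : ∀ i j, B (Q i) (Q j) = 0)
    (A : Matrix (Fin n) (Fin n) R) (hA : IsUnit A.det)
    (hPQ : ∀ i j, B (P i) (Q j) = algebraMap R K (A i j)) :
    Submodule.span K (Set.range P ∪ Set.range Q) = ⊤ ∧
    ∀ x, (∀ i, ∃ r : R, algebraMap R K r = B x (P i)) →
      (∀ i, ∃ r : R, algebraMap R K r = B x (Q i)) →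
      x ∈ Submodule.span R (Set.range P ∪ Set.range Q) := by
  classical
  let Q' : Fin n → V := fun j => ∑ l, A⁻¹ l j • Q l
  have hsm : ∀ (r : R) (v w : V), B v (r • w) = algebraMap R K r * B v w := by
    intro r v w
    rw [← algebraMap_smul K r w, map_smul, smul_eq_mul]
  have hQ'mem : ∀ j, Q' j ∈ Submodule.span R (Set.range P ∪ Set.range Q) := fun j =>
    Submodule.sum_mem _ fun l _ => Submodule.smul_mem _ _
      (Submodule.subset_span (Or.inr ⟨l, rfl⟩))
  have hPmem : ∀ j, P j ∈ Submodule.span R (Set.range P ∪ Set.range Q) := fun j =>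
    Submodule.subset_span (Or.inl ⟨j, rfl⟩)
  have hPQ' : ∀ i j, B (P i) (Q' j) = if i = j then 1 else 0 := by
    intro i j
    have h1 := congrFun (congrFun (Matrix.mul_nonsing_inv A hA) i) j
    rw [Matrix.mul_apply, Matrix.one_apply] at h1
    have h2 := congrArg (algebraMap R K) h1
    simp only [map_sum, map_mul] at h2
    simp only [Q', map_sum, hsm, hPQ]
    rw [show (if i = j then (1 : K) else 0) = algebraMap R K (if i = j then 1 else 0) by
      split_ifs <;> simp, ← h2]
    exact Finset.sum_congr rfl fun l _ => mul_comm _ _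
  have hQQ' : ∀ i j, B (Q i) (Q' j) = 0 := by
    intro i j
    simp [Q', hsm, hQ]
  have hQ'Q' : ∀ i j, B (Q' i) (Q' j) = 0 := by
    intro i j
    change B (Q' i) (∑ l, A⁻¹ l j • Q l) = 0
    rw [map_sum]
    refine Finset.sum_eq_zero fun l _ => ?_
    rw [hsm, hB, hQQ' l i, neg_zero, mul_zero]
  have hleft : ∀ (a b : Fin n → K) (j : Fin n),
      B (∑ i, a i • P i + ∑ i, b i • Q' i) (Q' j) = a j := by
    intro a b j
    simp [hPQ', hQ'Q']
  have hright : ∀ (a b : Fin n → K) (j : Fin n),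
      B (∑ i, a i • P i + ∑ i, b i • Q' i) (P j) = -b j := by
    intro a b j
    rw [hB]
    simp [hPQ', hP]
  have hlin : LinearIndependent K (Sum.elim P Q') := by
    rw [Fintype.linearIndependent_iff]
    intro c hc
    rw [Fintype.sum_sum_type] at hc
    simp only [Sum.elim_inl, Sum.elim_inr] at hc
    rintro (j | j)
    · have := hleft (fun i => c (Sum.inl i)) (fun i => c (Sum.inr i)) j
      rw [hc] at this
      simpa using this.symm
    · have := hright (fun i => c (Sum.inl i)) (fun i => c (Sum.inr i)) j
      rw [hc] at this
      simpa using this.symm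
  have hspan : Submodule.span K (Set.range (Sum.elim P Q')) = ⊤ := by
    refine LinearIndependent.span_eq_top_of_card_eq_finrank' hlin ?_
    simp [hV]
  refine ⟨?_, fun x hxP hxQ => ?_⟩
  · rw [eq_top_iff, ← hspan, Submodule.span_le]
    have hle : ∀ v, v ∈ Submodule.span R (Set.range P ∪ Set.range Q) →
        v ∈ Submodule.span K (Set.range P ∪ Set.range Q) := fun v hv =>
      Submodule.span_subset_span R K _ hv
    rintro _ ⟨i | i, rfl⟩
    exacts [hle _ (hPmem i), hle _ (hQ'mem i)]
  · have hx : x ∈ Submodule.span K (Set.range (Sum.elim P Q')) := hspan ▸ Submodule.mem_top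
    rw [Submodule.mem_span_range_iff_exists_fun] at hx
    obtain ⟨c, hc⟩ := hx
    rw [Fintype.sum_sum_type] at hc
    simp only [Sum.elim_inl, Sum.elim_inr] at hc
    rw [← hc]
    choose rP hrP using hxP
    choose rQ hrQ using hxQ
    refine Submodule.add_mem _ (Submodule.sum_mem _ fun i _ => ?_)
      (Submodule.sum_mem _ fun i _ => ?_)
    · have h1 : c (Sum.inl i) = algebraMap R K (∑ l, A⁻¹ l i * rQ l) := by
        rw [← hleft (fun i => c (Sum.inl i)) (fun i => c (Sum.inr i)) i, hc]
        simp [Q', hsm, hrQ]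
      rw [h1, algebraMap_smul]
      exact Submodule.smul_mem _ _ (hPmem i)
    · have h1 : c (Sum.inr i) = algebraMap R K (-rP i) := by
        rw [map_neg, hrP, ← hc, hright, neg_neg]
      rw [h1, algebraMap_smul]
      exact Submodule.smul_mem _ _ (hQ'mem i)

/-- `pairN` as a bilinear map. -/
def pairLin : Nspace p k g →ₗ[K(p, k)] Nspace p k g →ₗ[K(p, k)] K(p, k) :=
  LinearMap.mk₂ _ (pairN p k g)
    (fun a b c => by
      simp only [pairN, Prod.fst_add, Prod.snd_add, Pi.add_apply, ← Finset.sum_add_distrib]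
      exact Finset.sum_congr rfl fun i _ => by ring)
    (fun r a b => by
      simp only [pairN, Prod.smul_fst, Prod.smul_snd, Pi.smul_apply, smul_eq_mul, Finset.mul_sum]
      exact Finset.sum_congr rfl fun i _ => by ring)
    (fun a b c => by
      simp only [pairN, Prod.fst_add, Prod.snd_add, Pi.add_apply, ← Finset.sum_add_distrib]
      exact Finset.sum_congr rfl fun i _ => by ring)
    (fun r a b => by
      simp only [pairN, Prod.smul_fst, Prod.smul_snd, Pi.smul_apply, smul_eq_mul, Finset.mul_sum]
      exact Finset.sum_congr rfl fun i _ => by ring)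

lemma pairLin_apply (v w : Nspace p k g) : pairLin p k g v w = pairN p k g v w := rfl

lemma pairLin_neg (v w : Nspace p k g) : pairLin p k g v w = -pairLin p k g w v := by
  simp only [pairLin_apply, pairN]
  rw [← Equiv.sum_comp Fin.revPerm, ← Finset.sum_neg_distrib]
  refine Finset.sum_congr rfl fun i _ => ?_
  simp only [Fin.revPerm_apply, Fin.rev_rev]
  ring

/-- The integral version of `halfPow`. -/
def halfPowW (c : ℤ) : WittVector p k := if Even c then (p : WittVector p k) ^ (c / 2).toNat else 0

lemma algebraMap_halfPowW {c : ℤ} (hc : 0 ≤ c) :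
    algebraMap (WittVector p k) K(p, k) (halfPowW p k c) = halfPow p k c := by
  simp only [halfPowW, halfPow]
  split_ifs
  · rw [map_pow, map_natCast, ← zpow_natCast, Int.toNat_of_nonneg (by omega)]
  · simp

/-- The integral pairing of two vectors `twistVec`. -/
def gramValue (x : Fin g → WittVector p k) (t n s m : ℤ) : WittVector p k :=
  if n + m < g then 0 else halfPowW p k (n + m - g) *
    ((if Even n then 1 else -1) * (frobAut p k ^ t) (twistForm p k g x (s - t)))

lemma pairN_eq_zero {x : Fin g → WittVector p k}
    (hx : ∀ a : ℤ, 0 ≤ a → a < g → Even (a - g) → twistForm p k g x a = 0)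
    {t n s m : ℤ} (h1 : -(g : ℤ) < s - t) (h2 : s - t < g)
    (htn : Even (n - t)) (hsm : Even (m - s)) :
    pairN p k g (twistVec p k g x t n) (twistVec p k g x s m) = 0 := by
  rw [pairN_twistVec]
  by_cases h : Even (n + m - g)
  · rw [twistForm_eq_zero p k g hx h1 h2 (by rw [Int.even_iff] at *; omega)]
    simp
  · rw [halfPow, if_neg h, zero_mul]

lemma pairN_eq_gramValue {x : Fin g → WittVector p k}
    (hx : ∀ a : ℤ, 0 ≤ a → a < g → Even (a - g) → twistForm p k g x a = 0)
    {t n s m : ℤ} (h1 : -(n + m) ≤ s - t) (h2 : s - t ≤ n + m)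
    (htn : Even (n - t)) (hsm : Even (m - s)) :
    pairN p k g (twistVec p k g x t n) (twistVec p k g x s m)
      = algebraMap (WittVector p k) K(p, k) (gramValue p k g x t n s m) := by
  by_cases h : n + m < g
  · rw [gramValue, if_pos h, map_zero]
    exact pairN_eq_zero p k g hx (by omega) (by omega) htn hsm
  · rw [gramValue, if_neg h, pairN_twistVec, map_mul _ (halfPowW p k _),
      algebraMap_halfPowW p k (by omega)]

lemma isUnit_det_moore {x : Fin g → WittVector p k}
    (hx : ∀ a : ℤ, 0 ≤ a → a < g → Even (a - g) → twistForm p k g x a = 0)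
    (hu : IsUnit (twistForm p k g x g)) (e : ℤ) :
    IsUnit (Matrix.of fun j i : Fin g => (frobAut p k ^ (2 * (j : ℤ) + e)) (x i)).det := by
  let S : Matrix (Fin g) (Fin g) (WittVector p k) := Matrix.of fun l j =>
    cSign p k g l * (frobAut p k ^ (2 * (j : ℤ) + g + e)) (x (Fin.rev l))
  have hs : ∀ (t : ℤ) i, (frobAut p k ^ t) (cSign p k g i) = cSign p k g i := by
    intro t i; rw [cSign]; split_ifs <;> simp
  have hmul : (Matrix.of fun j i : Fin g => (frobAut p k ^ (2 * (j : ℤ) + e)) (x i)) * S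
      = Matrix.of fun i j : Fin g => (frobAut p k ^ (2 * (i : ℤ) + e))
        (twistForm p k g x (g + 2 * ((j : ℤ) - i))) := by
    ext1 i j
    simp only [Matrix.mul_apply, Matrix.of_apply, S, twistForm, map_sum, map_mul, hs,
      ← frobAut_zpow_add_apply]
    refine Finset.sum_congr rfl fun l _ => ?_
    rw [show 2 * (i : ℤ) + e + (g + 2 * ((j : ℤ) - i)) = 2 * (j : ℤ) + g + e by ring]
    ring
  refine isUnit_of_mul_isUnit_left (y := S.det) ?_
  rw [← Matrix.det_mul, hmul, Matrix.det_of_isUpperTriangular]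
  · refine (IsUnit.prod_univ_iff).mpr fun i => ?_
    simpa using hu.map (frobAut p k ^ (2 * (i : ℤ) + e))
  · intro i j hij
    have hij' : (j : ℕ) < i := hij
    have hi := i.2
    rw [Matrix.of_apply, twistForm_eq_zero p k g hx (by omega) (by omega), map_zero]
    exact ⟨(j : ℤ) - i, by ring⟩

/-- The first of the two isotropic families spanning `𝒟v`. -/
def isoFam₁ (x : Fin g → WittVector p k) (i : Fin g) : Nspace p k g := twistVec p k g x (-i) i

/-- The second of the two isotropic families spanning `𝒟v`. -/
def isoFam₂ (x : Fin g → WittVector p k) (j : Fin g) : Nspace p k g :=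
  twistVec p k g x (g - j) (g - j)

lemma twistVec_mem_Dspan (x : Fin g → WittVector p k) (a b : ℕ) :
    twistVec p k g x (a - b) (a + b) ∈ Dspan p k g (twistVec p k g x 0 0) := by
  rw [Dspan_twistVec]
  exact Submodule.subset_span ⟨a, b, rfl⟩

lemma isoFam_mem_Dspan (x : Fin g → WittVector p k) :
    Set.range (isoFam₁ p k g x) ∪ Set.range (isoFam₂ p k g x)
      ⊆ Dspan p k g (twistVec p k g x 0 0) := by
  rintro _ (⟨i, rfl⟩ | ⟨j, rfl⟩)
  · simpa [isoFam₁] using twistVec_mem_Dspan p k g x 0 i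
  · simpa [isoFam₂, Nat.cast_sub j.2.le] using twistVec_mem_Dspan p k g x (g - j) 0

lemma pairN_integral {x : Fin g → WittVector p k}
    (hx : ∀ a : ℤ, 0 ≤ a → a < g → Even (a - g) → twistForm p k g x a = 0)
    {v w : Nspace p k g} (hv : v ∈ Dspan p k g (twistVec p k g x 0 0))
    (hw : w ∈ Dspan p k g (twistVec p k g x 0 0)) :
    ∃ r : WittVector p k, algebraMap (WittVector p k) K(p, k) r = pairN p k g v w := by
  simp only [← pairLin_apply]
  rw [Dspan_twistVec] at hv hw
  have hsmul : ∀ (r : WittVector p k) (u : Nspace p k g), r • u = algebraMap _ K(p, k) r • u :=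
    fun r u => (algebraMap_smul _ r u).symm
  induction hv using Submodule.span_induction with
  | zero => exact ⟨0, by simp⟩
  | add u u' _ _ h h' =>
    obtain ⟨r, hr⟩ := h
    obtain ⟨r', hr'⟩ := h'
    exact ⟨r + r', by rw [map_add, hr, hr', map_add, LinearMap.add_apply]⟩
  | smul r u _ h =>
    obtain ⟨r', hr'⟩ := h
    exact ⟨r * r', by rw [map_mul, hr', hsmul, map_smul, LinearMap.smul_apply, smul_eq_mul]⟩
  | mem v hv =>
    obtain ⟨a, b, rfl⟩ := hv
    induction hw using Submodule.span_induction with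
    | zero => exact ⟨0, by simp⟩
    | add u u' _ _ h h' =>
      obtain ⟨r, hr⟩ := h
      obtain ⟨r', hr'⟩ := h'
      exact ⟨r + r', by rw [map_add, hr, hr', map_add]⟩
    | smul r u _ h =>
      obtain ⟨r', hr'⟩ := h
      exact ⟨r * r', by rw [map_mul, hr', hsmul, map_smul, smul_eq_mul]⟩
    | mem w hw =>
      obtain ⟨c, d, rfl⟩ := hw
      exact ⟨_, (pairN_eq_gramValue p k g hx (by omega) (by omega)
        ⟨b, by ring⟩ ⟨d, by ring⟩).symm⟩

lemma isUnit_det_gram {x : Fin g → WittVector p k} (hu : IsUnit (twistForm p k g x g)) :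
    IsUnit (Matrix.of fun i j : Fin g =>
      gramValue p k g x (-(i : ℤ)) i ((g : ℤ) - j) ((g : ℤ) - j)).det := by
  rw [Matrix.det_of_isLowerTriangular]
  · refine IsUnit.prod_univ_iff.mpr fun i => ?_
    have h := hu.map (frobAut p k ^ (-(i : ℤ)))
    simp only [Matrix.of_apply, gramValue, add_sub_cancel, lt_self_iff_false, if_false, sub_self,
      sub_neg_eq_add, sub_add_cancel, halfPowW]
    split_ifs <;> simp_all
  · intro i j hij
    have hij' : (i : ℕ) < j := hij
    rw [Matrix.of_apply, gramValue, if_pos (by omega)]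

lemma Dspan_isoFam {x : Fin g → WittVector p k}
    (hx : ∀ a : ℤ, 0 ≤ a → a < g → Even (a - g) → twistForm p k g x a = 0)
    (hu : IsUnit (twistForm p k g x g)) :
    Submodule.span K(p, k) (Set.range (isoFam₁ p k g x) ∪ Set.range (isoFam₂ p k g x)) = ⊤ ∧
    ∀ v, (∀ m ∈ Dspan p k g (twistVec p k g x 0 0),
        ∃ r : WittVector p k, algebraMap _ K(p, k) r = pairN p k g v m) →
      v ∈ Submodule.span (WittVector p k)
        (Set.range (isoFam₁ p k g x) ∪ Set.range (isoFam₂ p k g x)) := by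
  have key := unimodular_of_isotropic (R := WittVector p k) (by simp) (pairLin p k g)
    (pairLin_neg p k g) (isoFam₁ p k g x) (isoFam₂ p k g x)
    (fun i j => pairN_eq_zero p k g hx (by omega) (by omega) ⟨i, by ring⟩ ⟨j, by ring⟩)
    (fun i j => pairN_eq_zero p k g hx (by omega) (by omega) (by simp) (by simp))
    _ (isUnit_det_gram p k g hu)
    (fun i j => pairN_eq_gramValue p k g hx (by omega) (by omega) ⟨i, by ring⟩ (by simp))
  have hmem := isoFam_mem_Dspan p k g x
  exact ⟨key.1, fun v hv => key.2 v
    (fun i => hv _ (hmem (Or.inl ⟨i, rfl⟩))) (fun i => hv _ (hmem (Or.inr ⟨i, rfl⟩)))⟩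

lemma piVec_mem_Lambda0 (i : Fin g) (n : ℕ) : piVec p k g i n ∈ Lambda0 p k g := by
  rw [Lambda0_eq]
  induction n using Nat.twoStepInduction with
  | zero => exact Submodule.subset_span ⟨i, Or.inl rfl⟩
  | one => exact Submodule.subset_span ⟨i, Or.inr rfl⟩
  | more n ih _ =>
    push_cast
    rw [piVec_add_two]
    exact Submodule.smul_mem _ _ ih

lemma twistVec_mem_Lambda0 (x : Fin g → WittVector p k) (t : ℤ) (n : ℕ) :
    twistVec p k g x t n ∈ Lambda0 p k g :=
  Submodule.sum_mem _ fun i _ => Submodule.smul_mem _ _ (piVec_mem_Lambda0 p k g i n)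

lemma tauMap_piVec (i : Fin g) (n : ℤ) : tauMap p k g (piVec p k g i n) = piVec p k g i n := by
  ext j
  all_goals
    simp only [tauMap, piVec, Pi.single_apply]
    split_ifs <;> simp [sigmaK_halfPow]

lemma tauStable_Lambda0 : TauStable p k g (Lambda0 p k g) := by
  intro v hv
  rw [Lambda0_eq] at hv ⊢
  induction hv using Submodule.span_induction with
  | mem v hv =>
    obtain ⟨i, rfl | rfl⟩ := hv <;> rw [tauMap_piVec]
    exacts [Submodule.subset_span ⟨i, Or.inl rfl⟩, Submodule.subset_span ⟨i, Or.inr rfl⟩]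
  | zero =>
    rw [show tauMap p k g 0 = 0 by ext <;> simp [tauMap]]
    exact Submodule.zero_mem _
  | add u v _ _ hu hv =>
    rw [show tauMap p k g (u + v) = tauMap p k g u + tauMap p k g v by ext <;> simp [tauMap]]
    exact Submodule.add_mem _ hu hv
  | smul r v _ hv =>
    rw [show tauMap p k g (r • v) = frobAut p k (frobAut p k r) • tauMap p k g v by
      ext <;> simp [tauMap, Algebra.smul_def, sigmaK_algebraMap]]
    exact Submodule.smul_mem _ _ hv

lemma Mtau_le_Lambda0 (x : Fin g → WittVector p k) :
    Mtau p k g (Dspan p k g (twistVec p k g x 0 0)) ≤ Lambda0 p k g := by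
  rw [Mtau, Submodule.span_le, Set.iUnion_subset_iff]
  rintro i _ ⟨v, hv, rfl⟩
  have hle : Dspan p k g (twistVec p k g x 0 0) ≤ Lambda0 p k g := by
    rw [Dspan_twistVec, Submodule.span_le]
    rintro _ ⟨a, b, rfl⟩
    exact_mod_cast twistVec_mem_Lambda0 p k g x (a - b) (a + b)
  induction i with
  | zero => exact hle hv
  | succ i ih =>
    rw [Function.iterate_succ_apply']
    exact tauStable_Lambda0 p k g _ ih

lemma Lambda0_le_Mtau {x : Fin g → WittVector p k}
    (hx : ∀ a : ℤ, 0 ≤ a → a < g → Even (a - g) → twistForm p k g x a = 0)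
    (hu : IsUnit (twistForm p k g x g)) :
    Lambda0 p k g ≤ Mtau p k g (Dspan p k g (twistVec p k g x 0 0)) := by
  have htwist : ∀ j e : ℕ, twistVec p k g x (2 * j + e) e
      ∈ Mtau p k g (Dspan p k g (twistVec p k g x 0 0)) := by
    intro j e
    refine Submodule.subset_span (Set.mem_iUnion.mpr ⟨j, _, twistVec_mem_Dspan p k g x e 0, ?_⟩)
    rw [tauMap_iterate_twistVec]
    simp [add_comm]
  have hpi : ∀ (e : ℕ) (l : Fin g),
      piVec p k g l e ∈ Mtau p k g (Dspan p k g (twistVec p k g x 0 0)) := by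
    intro e l
    have hdet := isUnit_det_moore p k g hx hu e
    set T := Matrix.of fun j i : Fin g => (frobAut p k ^ (2 * (j : ℤ) + e)) (x i) with hT
    have : piVec p k g l e = ∑ j, T⁻¹ l j • twistVec p k g x (2 * (j : ℕ) + e) e := by
      calc piVec p k g l e = ∑ i, (1 : Matrix (Fin g) (Fin g) (WittVector p k)) l i
            • piVec p k g i e := by simp [Matrix.one_apply]
        _ = ∑ i, ∑ j, T⁻¹ l j • T j i • piVec p k g i e := by
          rw [← Matrix.nonsing_inv_mul T hdet]
          simp only [Matrix.mul_apply, Finset.sum_smul, mul_smul]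
        _ = _ := by
          rw [Finset.sum_comm]
          simp only [twistVec, Finset.smul_sum, hT, Matrix.of_apply]
    rw [this]
    exact Submodule.sum_mem _ fun j _ => Submodule.smul_mem _ _ (htwist j e)
  rw [Lambda0_eq, Submodule.span_le]
  rintro _ ⟨i, rfl | rfl⟩
  exacts [hpi 0 i, hpi 1 i]

/-- there exists `v ∈ N` such that `M := 𝒟v` is a `W`-lattice, `M` is
self-dual, and `M_τ = Λ₀`; i.e. `Λ₀ = M_τ` for a self-dual Dieudonné lattice
`M ⊆ N` of `a`-invariant 1. -/
theorem stmt12 (hg : 1 ≤ g) :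
    ∃ v : Nspace p k g,
      IsLattice p k g (Dspan p k g v) ∧
      dualSet p k g (Dspan p k g v : Set (Nspace p k g))
        = (Dspan p k g v : Set (Nspace p k g)) ∧
      Mtau p k g (Dspan p k g v) = Lambda0 p k g := by
  obtain ⟨x, hx, hu⟩ := exists_twistForm p k g hg
  obtain ⟨htop, hdual⟩ := Dspan_isoFam p k g hx hu
  have hmem := isoFam_mem_Dspan p k g x
  have hspan : Dspan p k g (twistVec p k g x 0 0) = Submodule.span (WittVector p k)
      (Set.range (isoFam₁ p k g x) ∪ Set.range (isoFam₂ p k g x)) :=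
    le_antisymm (fun v hv => hdual v fun m hm => pairN_integral p k g hx hv hm)
      (Submodule.span_le.mpr hmem)
  refine ⟨twistVec p k g x 0 0, ⟨?_, ?_⟩, ?_, ?_⟩
  · rw [hspan]
    exact Submodule.fg_span ((Set.finite_range _).union (Set.finite_range _))
  · exact top_le_iff.mp (htop.ge.trans (Submodule.span_mono hmem))
  · ext v
    refine ⟨fun hv => ?_, fun hv m hm => pairN_integral p k g hx hv hm⟩
    rw [SetLike.mem_coe, hspan]
    exact hdual v hv
  · exact le_antisymm (Mtau_le_Lambda0 p k g x) (Lambda0_le_Mtau p k g hx hu)
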